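/- There exists σ₀ > 0 such that for all 0 < σ < σ₀, ∫_{(−∞,0)} K_σ(x,[0,∞)) f_σ(x) dx ≥ (σ^{20}/(4√(2π)))·e^{−1/(2σ²)}·(σ^{10}/(4√(2π))) = (σ^{30}/(32π))·e^{−1/(2σ²)}. -/

import Mathlib

open MeasureTheory Filter Set

/-- Gaussian density `φ_σ` with mean 0 and variance `σ²`. -/
noncomputable def gaussDensity (σ x : ℝ) : ℝ :=
  (Real.sqrt (2 * Real.pi * σ ^ 2))⁻¹ * Real.exp (-(x ^ 2) / (2 * σ ^ 2))

/-- Density `f_σ` of the mixture `½ N(-1,σ²) + ½ N(1,σ²)`. -/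
noncomputable def mixDensity (σ x : ℝ) : ℝ :=
  (1 / 2) * gaussDensity σ (x + 1) + (1 / 2) * gaussDensity σ (x - 1)

/-- The random-walk Metropolis transition probability `K_σ(x, A)` (real-valued form):
`K_σ(x,A) = ∫ 1_A(x+z) min(1, f_σ(x+z)/f_σ(x)) φ_σ(z) dz
            + 1_A(x) (1 − ∫ min(1, f_σ(x+z)/f_σ(x)) φ_σ(z) dz)`. -/
noncomputable def rwmProb (σ x : ℝ) (A : Set ℝ) : ℝ :=
  (∫ z, A.indicator (fun _ => (1 : ℝ)) (x + z)
      * min 1 (mixDensity σ (x + z) / mixDensity σ x) * gaussDensity σ z)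
  + A.indicator (fun _ => (1 : ℝ)) x
      * (1 - ∫ z, min 1 (mixDensity σ (x + z) / mixDensity σ x) * gaussDensity σ z)

lemma gaussDensity_eq_gaussianPDFReal (σ x : ℝ) :
    gaussDensity σ x = ProbabilityTheory.gaussianPDFReal 0 ⟨σ ^ 2, sq_nonneg σ⟩ x := by
  simp [gaussDensity, ProbabilityTheory.gaussianPDFReal]
  rfl

lemma integrable_gaussDensity (σ : ℝ) : Integrable (gaussDensity σ) := by
  rw [funext (gaussDensity_eq_gaussianPDFReal σ)]
  exact ProbabilityTheory.integrable_gaussianPDFReal _ _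

lemma integral_gaussDensity {σ : ℝ} (hσ : 0 < σ) : ∫ z, gaussDensity σ z = 1 := by
  simp_rw [gaussDensity_eq_gaussianPDFReal]
  refine ProbabilityTheory.integral_gaussianPDFReal_eq_one _ fun h => ?_
  exact (pow_pos hσ 2).ne' (congrArg NNReal.toReal h)

lemma gaussDensity_pos {σ : ℝ} (hσ : 0 < σ) (x : ℝ) : 0 < gaussDensity σ x := by
  unfold gaussDensity
  positivity

lemma continuous_gaussDensity (σ : ℝ) : Continuous (gaussDensity σ) := by
  unfold gaussDensity
  fun_prop

lemma mixDensity_pos {σ : ℝ} (hσ : 0 < σ) (x : ℝ) : 0 < mixDensity σ x := by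
  have h₁ := gaussDensity_pos hσ (x + 1)
  have h₂ := gaussDensity_pos hσ (x - 1)
  unfold mixDensity
  positivity

lemma continuous_mixDensity (σ : ℝ) : Continuous (mixDensity σ) := by
  have h := continuous_gaussDensity σ
  unfold mixDensity
  fun_prop

lemma integrable_mixDensity (σ : ℝ) : Integrable (mixDensity σ) :=
  (((integrable_gaussDensity σ).comp_add_right 1).const_mul _).add
    (((integrable_gaussDensity σ).comp_sub_right 1).const_mul _)

/-- The mixture density dominates the geometric mean of its two components. -/
lemma exp_le_mixDensity (σ x : ℝ) :
    (Real.sqrt (2 * Real.pi * σ ^ 2))⁻¹ * Real.exp (-(x ^ 2 + 1) / (2 * σ ^ 2))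
      ≤ mixDensity σ x := by
  set u := Real.exp (-((x + 1) ^ 2) / (2 * σ ^ 2) / 2) with hu
  set v := Real.exp (-((x - 1) ^ 2) / (2 * σ ^ 2) / 2) with hv
  have huu : Real.exp (-((x + 1) ^ 2) / (2 * σ ^ 2)) = u * u := by
    rw [hu, ← Real.exp_add, add_halves]
  have hvv : Real.exp (-((x - 1) ^ 2) / (2 * σ ^ 2)) = v * v := by
    rw [hv, ← Real.exp_add, add_halves]
  have huv : Real.exp (-(x ^ 2 + 1) / (2 * σ ^ 2)) = u * v := by
    rw [hu, hv, ← Real.exp_add]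
    congr 1
    ring
  unfold mixDensity gaussDensity
  rw [huu, hvv, huv]
  have hs : 0 ≤ (Real.sqrt (2 * Real.pi * σ ^ 2))⁻¹ := by positivity
  nlinarith [mul_nonneg hs (sq_nonneg (u - v))]

lemma le_mixDensity_of_abs_le {σ x : ℝ} (hσ : 0 < σ) (hx : |x| ≤ σ) :
    (Real.sqrt (2 * Real.pi * σ ^ 2))⁻¹ * (Real.exp (-1 / (2 * σ ^ 2)) * Real.exp (-1 / 2))
      ≤ mixDensity σ x := by
  refine le_trans ?_ (exp_le_mixDensity σ x)
  rw [← Real.exp_add]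
  have hxx : x ^ 2 ≤ σ ^ 2 := sq_le_sq' (abs_le.1 hx).1 (abs_le.1 hx).2
  gcongr
  have h : (-1 : ℝ) / (2 * σ ^ 2) + -1 / 2 = -(σ ^ 2 + 1) / (2 * σ ^ 2) := by
    field_simp
    ring
  rw [h]
  gcongr

lemma le_gaussDensity_of_abs_le {σ z : ℝ} (hσ : 0 < σ) (hz : |z| ≤ 2 * σ) :
    (Real.sqrt (2 * Real.pi * σ ^ 2))⁻¹ * Real.exp (-2) ≤ gaussDensity σ z := by
  unfold gaussDensity
  have hzz : z ^ 2 ≤ (2 * σ) ^ 2 := sq_le_sq' (abs_le.1 hz).1 (abs_le.1 hz).2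
  gcongr
  rw [le_div_iff₀ (by positivity)]
  nlinarith

/-- The density in `z` of an accepted move from `x` to `x + z ∈ A`. -/
noncomputable def acceptedMove (σ : ℝ) (A : Set ℝ) (x z : ℝ) : ℝ :=
  A.indicator (fun _ => (1 : ℝ)) (x + z)
    * min 1 (mixDensity σ (x + z) / mixDensity σ x) * gaussDensity σ z

lemma rwmProb_of_notMem {x : ℝ} {A : Set ℝ} (σ : ℝ) (hx : x ∉ A) :
    rwmProb σ x A = ∫ z, acceptedMove σ A x z := by
  simp [rwmProb, acceptedMove, hx]

lemma measurable_acceptedMove (σ : ℝ) {A : Set ℝ} (hA : MeasurableSet A) :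
    Measurable (Function.uncurry (acceptedMove σ A)) := by
  have hf := (continuous_mixDensity σ).measurable
  have hg := (continuous_gaussDensity σ).measurable
  have hi : Measurable (A.indicator (fun _ => (1 : ℝ))) := measurable_const.indicator hA
  unfold acceptedMove Function.uncurry
  fun_prop

lemma acceptedMove_nonneg {σ : ℝ} (hσ : 0 < σ) (A : Set ℝ) (x z : ℝ) :
    0 ≤ acceptedMove σ A x z := by
  have h₁ := mixDensity_pos hσ x
  have h₂ := mixDensity_pos hσ (x + z)
  have h₃ := gaussDensity_pos hσ z
  have h₄ : 0 ≤ A.indicator (fun _ => (1 : ℝ)) (x + z) :=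
    indicator_nonneg (fun _ _ => zero_le_one) _
  unfold acceptedMove
  positivity

lemma acceptedMove_le {σ : ℝ} (hσ : 0 < σ) (A : Set ℝ) (x z : ℝ) :
    acceptedMove σ A x z ≤ gaussDensity σ z := by
  have h₁ := mixDensity_pos hσ x
  have h₂ := mixDensity_pos hσ (x + z)
  have h₄ : A.indicator (fun _ => (1 : ℝ)) (x + z) ≤ 1 :=
    indicator_le_self' (fun _ _ => zero_le_one) _
  refine mul_le_of_le_one_left (gaussDensity_pos hσ z).le ?_
  exact mul_le_one₀ h₄ (by positivity) (min_le_left _ _)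

lemma integrable_acceptedMove {σ : ℝ} (hσ : 0 < σ) {A : Set ℝ} (hA : MeasurableSet A) (x : ℝ) :
    Integrable (acceptedMove σ A x) := by
  refine (integrable_gaussDensity σ).mono'
    ((measurable_acceptedMove σ hA).comp measurable_prodMk_left).aestronglyMeasurable
    (.of_forall fun z => ?_)
  rw [Real.norm_of_nonneg (acceptedMove_nonneg hσ A x z)]
  exact acceptedMove_le hσ A x z

lemma integrable_integral_acceptedMove_mul {σ : ℝ} (hσ : 0 < σ) {A : Set ℝ}
    (hA : MeasurableSet A) :
    Integrable fun x => (∫ z, acceptedMove σ A x z) * mixDensity σ x := by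
  have hm : StronglyMeasurable fun x => ∫ z, acceptedMove σ A x z :=
    (measurable_acceptedMove σ hA).stronglyMeasurable.integral_prod_right
  refine (integrable_mixDensity σ).mono'
    (hm.mul (continuous_mixDensity σ).stronglyMeasurable).aestronglyMeasurable
    (.of_forall fun x => ?_)
  have h₀ : 0 ≤ ∫ z, acceptedMove σ A x z := integral_nonneg (acceptedMove_nonneg hσ A x)
  have h₁ : ∫ z, acceptedMove σ A x z ≤ 1 := by
    rw [← integral_gaussDensity hσ]
    exact integral_mono (integrable_acceptedMove hσ hA x) (integrable_gaussDensity σ)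
      (acceptedMove_le hσ A x)
  have hf := mixDensity_pos hσ x
  rw [Real.norm_of_nonneg (mul_nonneg h₀ hf.le)]
  exact mul_le_of_le_one_left hf.le h₁

/-- Moves from `[-σ, 0)` into `[0, ∞)` of length at most `2σ` are accepted often enough. -/
lemma le_integral_acceptedMove_mul {σ x : ℝ} (hσ : 0 < σ) (hx : x ∈ Ico (-σ) 0) :
    σ * (((Real.sqrt (2 * Real.pi * σ ^ 2))⁻¹
        * (Real.exp (-1 / (2 * σ ^ 2)) * Real.exp (-1 / 2)))
        * ((Real.sqrt (2 * Real.pi * σ ^ 2))⁻¹ * Real.exp (-2)))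
      ≤ (∫ z, acceptedMove σ (Ici 0) x z) * mixDensity σ x := by
  set m := (Real.sqrt (2 * Real.pi * σ ^ 2))⁻¹
    * (Real.exp (-1 / (2 * σ ^ 2)) * Real.exp (-1 / 2))
  set g := (Real.sqrt (2 * Real.pi * σ ^ 2))⁻¹ * Real.exp (-2)
  have hx₁ : -σ ≤ x := hx.1
  have hx₂ : x < 0 := hx.2
  have hint : Integrable fun z => acceptedMove σ (Ici 0) x z * mixDensity σ x :=
    (integrable_acceptedMove hσ measurableSet_Ici x).mul_const _
  rw [← integral_mul_const]
  calc σ * (m * g) = ∫ _z in Icc (-x) (-x + σ), m * g := by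
        simp [Measure.real, hσ.le]
    _ ≤ ∫ z in Icc (-x) (-x + σ), acceptedMove σ (Ici 0) x z * mixDensity σ x := by
        refine setIntegral_mono_on (integrableOn_const (by simp)) hint.integrableOn measurableSet_Icc fun z hz => ?_
        have hz₁ : -x ≤ z := hz.1
        have hz₂ : z ≤ -x + σ := hz.2
        have hmem : x + z ∈ Ici (0 : ℝ) := by
          rw [mem_Ici]
          linarith
        have hfx := mixDensity_pos hσ x
        have hmx : m ≤ mixDensity σ x :=
          le_mixDensity_of_abs_le hσ (abs_le.2 ⟨hx₁, by linarith⟩)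
        have hmy : m ≤ mixDensity σ (x + z) :=
          le_mixDensity_of_abs_le hσ (abs_le.2 ⟨by linarith, by linarith⟩)
        have hgz : g ≤ gaussDensity σ z :=
          le_gaussDensity_of_abs_le hσ (abs_le.2 ⟨by linarith, by linarith⟩)
        have heq : acceptedMove σ (Ici 0) x z * mixDensity σ x
            = min (mixDensity σ x) (mixDensity σ (x + z)) * gaussDensity σ z := by
          rw [acceptedMove, indicator_of_mem hmem, one_mul, mul_right_comm,
            min_mul_of_nonneg _ _ hfx.le, one_mul, div_mul_cancel₀ _ hfx.ne']
        rw [heq]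
        exact mul_le_mul (le_min hmx hmy) hgz (by positivity)
          (le_min hfx.le (mixDensity_pos hσ _).le)
    _ ≤ ∫ z, acceptedMove σ (Ici 0) x z * mixDensity σ x :=
        setIntegral_le_integral hint (.of_forall fun z =>
          mul_nonneg (acceptedMove_nonneg hσ _ x z) (mixDensity_pos hσ x).le)

/-- Lower bound on the unnormalized conductance integral of the half line. -/
theorem stmt6 :
    ∃ σ₀ : ℝ, 0 < σ₀ ∧ ∀ σ : ℝ, 0 < σ → σ < σ₀ →
      (σ ^ 20 / (4 * Real.sqrt (2 * Real.pi))) * Real.exp (-1 / (2 * σ ^ 2))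
          * (σ ^ 10 / (4 * Real.sqrt (2 * Real.pi)))
        ≤ ∫ x in Set.Iio (0 : ℝ), rwmProb σ x (Set.Ici 0) * mixDensity σ x := by
  refine ⟨1 / 2, by norm_num, fun σ hσ hσ' => ?_⟩
  have heq : ∫ x in Iio (0 : ℝ), rwmProb σ x (Ici 0) * mixDensity σ x
      = ∫ x in Iio (0 : ℝ), (∫ z, acceptedMove σ (Ici 0) x z) * mixDensity σ x := by
    refine setIntegral_congr_fun measurableSet_Iio fun x hx => ?_
    simp only [rwmProb_of_notMem σ (notMem_Ici.2 hx)]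
  have hint := integrable_integral_acceptedMove_mul hσ (measurableSet_Ici (a := (0 : ℝ)))
  have hlow := setIntegral_mono_on (f := fun _ => σ * (((Real.sqrt (2 * Real.pi * σ ^ 2))⁻¹
        * (Real.exp (-1 / (2 * σ ^ 2)) * Real.exp (-1 / 2)))
        * ((Real.sqrt (2 * Real.pi * σ ^ 2))⁻¹ * Real.exp (-2)))) (s := Ico (-σ) 0)
    (integrableOn_const (by simp)) hint.integrableOn measurableSet_Ico
    fun x hx => le_integral_acceptedMove_mul hσ hx
  have hmono : ∫ x in Ico (-σ) 0, (∫ z, acceptedMove σ (Ici 0) x z) * mixDensity σ x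
      ≤ ∫ x in Iio (0 : ℝ), (∫ z, acceptedMove σ (Ici 0) x z) * mixDensity σ x :=
    setIntegral_mono_set hint.integrableOn
      (.of_forall fun x => mul_nonneg (integral_nonneg (acceptedMove_nonneg hσ _ x))
        (mixDensity_pos hσ x).le)
      Ico_subset_Iio_self.eventuallyLE
  rw [heq]
  refine le_trans ?_ (hlow.trans hmono)
  have hpow : σ ^ 30 ≤ 1 / 2 :=
    (pow_le_of_le_one hσ.le (by linarith) (by norm_num)).trans hσ'.le
  have hexp : 1 / 27 ≤ Real.exp (-1 / 2) * Real.exp (-2) := by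
    have h₃ : Real.exp 3 ≤ 27 := by
      have h : Real.exp 3 = Real.exp 1 ^ 3 := by
        rw [← Real.exp_nat_mul]
        norm_num
      rw [h]
      calc Real.exp 1 ^ 3 ≤ 3 ^ 3 := by
            gcongr
            linarith [Real.exp_one_lt_d9]
        _ = 27 := by norm_num
    calc (1 : ℝ) / 27 ≤ 1 / Real.exp 3 := by gcongr
      _ = Real.exp (-3) := by rw [Real.exp_neg, one_div]
      _ ≤ Real.exp (-1 / 2 + -2) := Real.exp_le_exp.2 (by norm_num)
      _ = _ := Real.exp_add _ _
  have hroot : Real.sqrt (2 * Real.pi * σ ^ 2) = Real.sqrt (2 * Real.pi) * σ := by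
    rw [Real.sqrt_mul (by positivity), Real.sqrt_sq hσ.le]
  have hvol : volume.real (Ico (-σ) 0) = σ := by
    simp [Measure.real, hσ.le]
  rw [setIntegral_const, hvol, smul_eq_mul, hroot]
  have hS : 0 < Real.sqrt (2 * Real.pi) := by positivity
  set S := Real.sqrt (2 * Real.pi)
  set E := Real.exp (-1 / (2 * σ ^ 2))
  calc σ ^ 20 / (4 * S) * E * (σ ^ 10 / (4 * S)) = E / S ^ 2 * (σ ^ 30 / 16) := by
        field_simp
        ring
    _ ≤ E / S ^ 2 * (Real.exp (-1 / 2) * Real.exp (-2)) := by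
        gcongr
        linarith
    _ = _ := by
        field_simp
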